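/- arXiv:2311.04513 — 6 statements merged into one kernel-verified Lean document; each statement's English description precedes it below -/
import Mathlib

section
/- Let R, R* : ℝ → ℝ be cumulative functions, let α : ℝ → ℝ be an arrival curve of R, and let 0 ≤ D_min ≤ D_max be reals such that for all t, R(t - D_max) ≤ R*(t) ≤ R(t - D_min) (i.e., every bit is delayed by at least D_min and at most D_max). Then for all x ≤ y, R*(y) - R*(x) ≤ α(y - x + D_max - D_min); that is, the function t ↦ α(t + D_max - D_min) is an arrival curve of the output R*. -/
/-- `α` is an arrival curve of the cumulative function `R`. -/
def IsArrivalCurve (α R : ℝ → ℝ) : Prop :=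
  ∀ s t : ℝ, s ≤ t → R t - R s ≤ α (t - s)

/-- **Output from Delay.** If the output `R*` delays the input `R` by at least
`Dmin` and at most `Dmax`, then `t ↦ α (t + Dmax - Dmin)` is an arrival curve
of the output `R*`. -/
theorem output_from_delay (R Rstar α : ℝ → ℝ) (Dmin Dmax : ℝ)
    (hα : IsArrivalCurve α R)
    (hDmin : 0 ≤ Dmin) (hDle : Dmin ≤ Dmax)
    (hlow : ∀ t : ℝ, R (t - Dmax) ≤ Rstar t)
    (hup : ∀ t : ℝ, Rstar t ≤ R (t - Dmin)) :
    ∀ x y : ℝ, x ≤ y → Rstar y - Rstar x ≤ α (y - x + Dmax - Dmin) := by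
  intro x y hxy
  have h := hα (x - Dmax) (y - Dmin) (by linarith)
  rw [show y - Dmin - (x - Dmax) = y - x + Dmax - Dmin by ring] at h
  linarith [hlow x, hup y]
end

section
/- Let R, R* : ℝ → ℝ be cumulative functions, let α : ℝ → ℝ be an arrival curve of R, and let D_max ≥ 0 be a real such that for all t, R*(t) ≤ R(t) (causality) and R*(t) ≥ R(t - D_max) (maximum delay D_max). Then for all x ≤ y, R*(y) - R*(x) ≤ α(y - x + D_max); that is, t ↦ α(t + D_max) is an arrival curve of the output R*. -/
/-- **Output from maximum delay (Cruz, Theorem 2.1).** If the causal output `R*`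
delays the input `R` by at most `Dmax`, then `t ↦ α (t + Dmax)` is an arrival
curve of the output `R*`. -/
theorem output_from_max_delay (R Rstar α : ℝ → ℝ) (Dmax : ℝ)
    (hα : IsArrivalCurve α R)
    (hDmax : 0 ≤ Dmax)
    (hcausal : ∀ t : ℝ, Rstar t ≤ R t)
    (hdelay : ∀ t : ℝ, R (t - Dmax) ≤ Rstar t) :
    ∀ x y : ℝ, x ≤ y → Rstar y - Rstar x ≤ α (y - x + Dmax) := by
  intro x y hxy
  have h := hα (x - Dmax) y (by linarith)
  rw [show y - (x - Dmax) = y - x + Dmax by ring] at h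
  linarith [hcausal y, hdelay x]
end

section
/- Let R : ℝ → ℝ be a nondecreasing cumulative function with arrival curve α, and let R* : ℝ → ℝ satisfy the service-curve guarantee R*(t) ≥ inf_{s ≤ t} (R(s) + β(t - s)) for a nondecreasing nonnegative function β : ℝ → ℝ with β(u) = 0 for u ≤ 0. Let h(α, β) = sup_{s ≥ 0} inf {τ ≥ 0 : α(s) ≤ β(s + τ)} be the horizontal deviation between α and β. Then for every t and every d > h(α, β), R(t) ≤ R*(t + d); that is, the virtual delay at every time t is at most h(α, β). -/
/-- The horizontal deviation `h(α, β) = sup_{s ≥ 0} inf {τ ≥ 0 : α s ≤ β (s + τ)}`,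
valued in `EReal` (an empty infimum is `⊤`). -/
noncomputable def horizDev (α β : ℝ → ℝ) : EReal :=
  ⨆ s ∈ Set.Ici (0 : ℝ), ⨅ τ ∈ {τ : ℝ | 0 ≤ τ ∧ α s ≤ β (s + τ)}, (τ : EReal)

/-- A delay exceeding the horizontal deviation shifts `β` above `α` on `[0, ∞)`. -/
theorem le_of_horizDev_lt {α β : ℝ → ℝ} (hβ : Monotone β) {d u : ℝ}
    (hd : horizDev α β < (d : EReal)) (hu : 0 ≤ u) : α u ≤ β (u + d) := by
  have h : ⨅ τ ∈ {τ : ℝ | 0 ≤ τ ∧ α u ≤ β (u + τ)}, (τ : EReal) < (d : EReal) :=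
    (le_iSup₂ (f := fun s (_ : s ∈ Set.Ici (0 : ℝ)) ↦
      ⨅ τ ∈ {τ : ℝ | 0 ≤ τ ∧ α s ≤ β (s + τ)}, (τ : EReal)) u hu).trans_lt hd
  simp only [iInf_lt_iff] at h
  obtain ⟨τ, ⟨-, hτ⟩, hτd⟩ := h
  have hτd : τ < d := EReal.coe_lt_coe_iff.mp hτd
  exact hτ.trans (hβ (by linarith))

/-- **Delay Bound (Le Boudec, Theorem 1.4.2).** If `R` is a nondecreasing input
with arrival curve `α` and the output `R*` satisfies the service-curve
guarantee for a nondecreasing, nonnegative `β` vanishing on `(-∞, 0]`, then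
the virtual delay at every time `t` is at most the horizontal deviation
`h(α, β)`: for every `d > h(α, β)` we have `R t ≤ R* (t + d)`. -/
theorem delay_bound (R Rstar α β : ℝ → ℝ)
    (hRmono : Monotone R)
    (hα : IsArrivalCurve α R)
    (hβmono : Monotone β)
    (hβnonneg : ∀ u : ℝ, 0 ≤ β u)
    (hβzero : ∀ u : ℝ, u ≤ 0 → β u = 0)
    (hservice : ∀ t : ℝ, sInf {x : ℝ | ∃ s : ℝ, s ≤ t ∧ x = R s + β (t - s)} ≤ Rstar t) :
    ∀ t d : ℝ, horizDev α β < (d : EReal) → R t ≤ Rstar (t + d) := by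
  intro t d hd
  refine le_trans (le_csInf ?_ ?_) (hservice (t + d))
  · exact ⟨_, t + d, le_rfl, rfl⟩
  rintro _ ⟨s, -, rfl⟩
  rcases le_total s t with hst | hts
  · have h₁ := hα s t hst
    have h₂ := le_of_horizDev_lt hβmono hd (sub_nonneg.mpr hst)
    rw [sub_add_eq_add_sub] at h₂
    linarith
  · linarith [hRmono hts, hβnonneg (t + d - s)]
end

section
/- Let CMI > 0 and m ≥ 0 be reals, t₀ ∈ ℝ, and let (a_k)_{k ∈ ℕ} be reals with 0 ≤ a_k ≤ m for all k. Define the cumulative function R(t) = Σ_{k ∈ ℕ, t₀ + k·CMI ≤ t} a_k (a periodic flow that transmits at most m data at each instant t₀ + k·CMI). Then for all s ≤ t, R(t) - R(s) ≤ m · ⌈(t - s)/CMI⌉; that is, the staircase function t ↦ m·⌈t/CMI⌉ is an arrival curve of R. -/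
/-- The number of release instants `t₀ + k * CMI` with `k : ℕ` that do not exceed `t`. -/
noncomputable def releaseCount (CMI t₀ t : ℝ) : ℕ :=
  (⌊(t - t₀) / CMI⌋ + 1).toNat

lemma lt_releaseCount_iff {CMI : ℝ} (hCMI : 0 < CMI) (t₀ t : ℝ) (k : ℕ) :
    k < releaseCount CMI t₀ t ↔ t₀ + (k : ℝ) * CMI ≤ t := by
  rw [releaseCount, Int.lt_toNat, Int.lt_add_one_iff, Int.le_floor, le_div_iff₀ hCMI,
    Int.cast_natCast, le_sub_iff_add_le']

lemma tsum_release_eq_sum_range {CMI : ℝ} (hCMI : 0 < CMI) (t₀ t : ℝ) (a : ℕ → ℝ) :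
    (∑' k : ℕ, if t₀ + (k : ℝ) * CMI ≤ t then a k else 0) =
      ∑ k ∈ Finset.range (releaseCount CMI t₀ t), a k := by
  simp_rw [← lt_releaseCount_iff hCMI]
  rw [tsum_eq_sum (s := Finset.range (releaseCount CMI t₀ t))
    fun k hk => if_neg (by simpa using hk)]
  exact Finset.sum_congr rfl fun k hk => if_pos (Finset.mem_range.mp hk)

lemma releaseCount_mono {CMI : ℝ} (hCMI : 0 < CMI) (t₀ : ℝ) :
    Monotone (releaseCount CMI t₀) := by
  intro s t hst
  exact Int.toNat_le_toNat (by gcongr)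

lemma releaseCount_le_add_ceil {CMI : ℝ} (hCMI : 0 < CMI) (t₀ : ℝ) {s t : ℝ} (hst : s ≤ t) :
    (releaseCount CMI t₀ t : ℤ) ≤ releaseCount CMI t₀ s + ⌈(t - s) / CMI⌉ := by
  have hceil : 0 ≤ ⌈(t - s) / CMI⌉ :=
    Int.ceil_nonneg (div_nonneg (sub_nonneg.mpr hst) hCMI.le)
  have hfloor : ⌊(t - t₀) / CMI⌋ ≤ ⌊(s - t₀) / CMI⌋ + ⌈(t - s) / CMI⌉ := by
    rw [← Int.floor_add_intCast]
    apply Int.floor_le_floor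
    calc (t - t₀) / CMI = (s - t₀) / CMI + (t - s) / CMI := by ring
      _ ≤ _ := by gcongr; exact Int.le_ceil _
  unfold releaseCount
  omega

/-- **Flow Arrival.** A periodic flow that transmits at most `m` data at each
instant `t₀ + k·CMI` (`k ∈ ℕ`) admits the staircase function
`t ↦ m·⌈t / CMI⌉` as an arrival curve. -/
theorem flow_arrival (CMI m t₀ : ℝ) (a : ℕ → ℝ)
    (hCMI : 0 < CMI) (hm : 0 ≤ m)
    (ha : ∀ k : ℕ, 0 ≤ a k ∧ a k ≤ m)
    (R : ℝ → ℝ)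
    (hR : ∀ t : ℝ, R t = ∑' k : ℕ, if t₀ + (k : ℝ) * CMI ≤ t then a k else 0) :
    IsArrivalCurve (fun t => m * ⌈t / CMI⌉) R := by
  intro s t hst
  have hmono := releaseCount_mono hCMI t₀ hst
  have hcount : (releaseCount CMI t₀ t : ℝ) ≤ releaseCount CMI t₀ s + ⌈(t - s) / CMI⌉ := by
    exact_mod_cast releaseCount_le_add_ceil hCMI t₀ hst
  rw [hR, hR, tsum_release_eq_sum_range hCMI, tsum_release_eq_sum_range hCMI,
    ← Finset.sum_Ico_eq_sub _ hmono]
  calc ∑ k ∈ Finset.Ico (releaseCount CMI t₀ s) (releaseCount CMI t₀ t), a k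
      ≤ ∑ _k ∈ Finset.Ico (releaseCount CMI t₀ s) (releaseCount CMI t₀ t), m :=
        Finset.sum_le_sum fun k _ => (ha k).2
    _ = m * ((releaseCount CMI t₀ t : ℝ) - releaseCount CMI t₀ s) := by
        rw [Finset.sum_const, Nat.card_Ico, nsmul_eq_mul, Nat.cast_sub hmono, mul_comm]
    _ ≤ m * ⌈(t - s) / CMI⌉ := by
        gcongr
        linarith
end

section
/- Let flows f ∈ F be partitioned into groups (F_q)_{q ∈ Q} (flows sharing the same preceding queue). Each flow f has source cumulative function R_f^in with arrival curve α_f, arrival R_f at the queue of interest, and accumulated delay bounds 0 ≤ D̲_f ≤ D̄_f with R_f^in(t - D̄_f) ≤ R_f(t) ≤ R_f^in(t - D̲_f) for all t. Suppose moreover that for each group q the group aggregate Σ_{f ∈ F_q} R_f has σ_q as an arrival curve (the shaping curve of the preceding queue). Then α(t) = Σ_{q ∈ Q} min( Σ_{f ∈ F_q} α_f(t + D̄_f - D̲_f), σ_q(t) ) is an arrival curve of the total aggregate Σ_{f ∈ F} R_f. -/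
/-- **Improved aggregate arrival curve (paper's Eq. (16)).** Flows `f : F` are
partitioned into groups by `grp : F → Q` (flows sharing the same preceding
queue). Each flow has source arrival curve `α f` and its arrival `R f` at the
queue of interest is delayed between `Dlo f` and `Dhi f` relative to the
source `Rin f`; moreover, each group aggregate is shaped by `σ q`. Then
`t ↦ Σ_q min (Σ_{f ∈ F_q} α f (t + Dhi f - Dlo f), σ q t)` is an arrival
curve of the total aggregate `Σ_f R f`. -/
theorem shaped_aggregate_arrival_curve
    (F Q : Type*) [Fintype F] [Fintype Q] [DecidableEq Q]
    (grp : F → Q)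
    (Rin R α : F → ℝ → ℝ) (Dlo Dhi : F → ℝ) (σ : Q → ℝ → ℝ)
    (hα : ∀ f : F, IsArrivalCurve (α f) (Rin f))
    (hD : ∀ f : F, 0 ≤ Dlo f ∧ Dlo f ≤ Dhi f)
    (hdelay : ∀ f : F, ∀ t : ℝ,
      Rin f (t - Dhi f) ≤ R f t ∧ R f t ≤ Rin f (t - Dlo f))
    (hshape : ∀ q : Q,
      IsArrivalCurve (σ q)
        (fun t => ∑ f ∈ Finset.univ.filter (fun f => grp f = q), R f t)) :
    IsArrivalCurve
      (fun t => ∑ q : Q,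
        min (∑ f ∈ Finset.univ.filter (fun f => grp f = q),
              α f (t + Dhi f - Dlo f))
            (σ q t))
      (fun t => ∑ f : F, R f t) := by
  intro s t hst
  have fiberwise : ∀ u : ℝ, ∑ f : F, R f u =
      ∑ q : Q, ∑ f ∈ Finset.univ.filter (fun f => grp f = q), R f u :=
    fun u => (Finset.sum_fiberwise Finset.univ grp fun f => R f u).symm
  simp only [fiberwise]
  rw [← Finset.sum_sub_distrib]
  refine Finset.sum_le_sum fun q _ => le_min ?_ (hshape q s t hst)
  rw [← Finset.sum_sub_distrib]
  refine Finset.sum_le_sum fun f _ => ?_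
  have hsource := hα f (s - Dhi f) (t - Dlo f) (by linarith [(hD f).2])
  rw [show t - Dlo f - (s - Dhi f) = t - s + Dhi f - Dlo f by ring] at hsource
  linarith [(hdelay f t).2, (hdelay f s).1]
end

section
/- Let r > 0 (idleSlope), T > 0 (class measurement interval CMI), L > 0 (packet size), and K > 0 (fixed per-hop transmission overhead (L_max + L)/C) be reals with L ≥ r·T. Define sequences b, D : ℕ → ℝ by b(0) ≥ L, D(n) = (2·b(n))/r + K (the worst-case delay at the second hop of recursion level n, where the cross-traffic burst equals the flow-of-interest burst accumulated at the previous recursion level), and b(n+1) = L·⌈D(n)/T⌉ (the burstiness accumulated from the delay jitter D(n)). Then b(n+1) ≥ 2·b(n) + (L/T)·K for all n, and consequently D(n) → ∞ as n → ∞; in particular the sequence of worst-case per-hop delays is unbounded. -/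
/-- **Unbounded Local Delay (recurrence of the paper's Theorem 1).** With
idleSlope `r > 0`, period `T > 0`, packet size `L > 0`, per-hop overhead
`K > 0` and `L ≥ r·T`, the recursion
`D n = 2·b n / r + K`, `b (n+1) = L·⌈D n / T⌉`, started at `b 0 ≥ L`,
satisfies `b (n+1) ≥ 2·b n + (L/T)·K` for all `n`, and the worst-case delays
`D n` tend to infinity, i.e. they are unbounded. -/
theorem unbounded_local_delay (r T L K : ℝ) (b D : ℕ → ℝ)
    (hr : 0 < r) (hT : 0 < T) (hL : 0 < L) (hK : 0 < K)
    (hLrT : r * T ≤ L)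
    (hb0 : L ≤ b 0)
    (hD : ∀ n : ℕ, D n = 2 * b n / r + K)
    (hb : ∀ n : ℕ, b (n + 1) = L * ⌈D n / T⌉) :
    (∀ n : ℕ, 2 * b n + (L / T) * K ≤ b (n + 1)) ∧
      Filter.Tendsto D Filter.atTop Filter.atTop := by
  have step : ∀ n, 0 ≤ b n → 2 * b n + (L / T) * K ≤ b (n + 1) := by
    intro n hn
    have hratio : 1 ≤ L / (r * T) := (one_le_div (mul_pos hr hT)).2 hLrT
    calc 2 * b n + (L / T) * K
        ≤ L / (r * T) * (2 * b n) + (L / T) * K := by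
          exact add_le_add_left (le_mul_of_one_le_left (by positivity) hratio) _
      _ = L * (D n / T) := by
          rw [hD]
          field_simp
      _ ≤ L * ⌈D n / T⌉ := by
          gcongr
          exact Int.le_ceil _
      _ = b (n + 1) := (hb n).symm
  have hc : 0 < (L / T) * K := by positivity
  have nonneg : ∀ n, 0 ≤ b n := by
    intro n
    induction n with
    | zero => exact hL.le.trans hb0
    | succ n ih => linarith [step n ih]
  have growth : ∀ n : ℕ, n * ((L / T) * K) ≤ b n := by
    intro n
    induction n with
    | zero => simpa using nonneg 0
    | succ n ih =>
      push_cast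
      linarith [step n (nonneg n), nonneg n]
  refine ⟨fun n => step n (nonneg n), ?_⟩
  have hb_top : Filter.Tendsto b Filter.atTop Filter.atTop :=
    Filter.tendsto_atTop_mono growth (tendsto_natCast_atTop_atTop.atTop_mul_const hc)
  rw [funext hD]
  exact Filter.tendsto_atTop_add_const_right _ _
    ((hb_top.const_mul_atTop two_pos).atTop_div_const hr)
end
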